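/- For every finite simple graph G on a vertex set V and every vertex x ∈ V, box(G) ≤ 1 + box(G − x), where G − x denotes the induced subgraph of G on V ∖ {x}. -/

import Mathlib

/-- A finite simple graph `H` is an interval graph if there is an assignment of
real intervals `[l v, r v]` (with `l v ≤ r v`) to the vertices such that distinct
vertices are adjacent iff their intervals intersect. -/
def IsIntervalGraph {V : Type*} (H : SimpleGraph V) : Prop :=
  ∃ l r : V → ℝ, (∀ v, l v ≤ r v) ∧
    ∀ u v : V, u ≠ v →
      (H.Adj u v ↔ (Set.Icc (l u) (r u) ∩ Set.Icc (l v) (r v)).Nonempty)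

/-- The boxicity of `G` : the least `k` such that `G` is the edge-intersection of
`k` interval graphs on the same vertex set. -/
noncomputable def boxicity {V : Type*} (G : SimpleGraph V) : ℕ :=
  sInf {k | ∃ I : Fin k → SimpleGraph V,
    (∀ i, IsIntervalGraph (I i)) ∧ ∀ u v : V, G.Adj u v ↔ ∀ i, (I i).Adj u v}

theorem isIntervalGraph_iff {V : Type*} {H : SimpleGraph V} :
    IsIntervalGraph H ↔ ∃ l r : V → ℝ, (∀ v, l v ≤ r v) ∧
      ∀ u v : V, H.Adj u v ↔ u ≠ v ∧ l u ≤ r v ∧ l v ≤ r u := by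
  refine exists_congr fun l => exists_congr fun r => and_congr_right fun hlr => ?_
  refine forall₂_congr fun u v => ?_
  rw [Set.Icc_inter_Icc, Set.nonempty_Icc, sup_le_iff, le_inf_iff, le_inf_iff]
  have hu := hlr u
  have hv := hlr v
  have hne : H.Adj u v → u ≠ v := H.ne_of_adj
  tauto

theorem IsIntervalGraph.induce {V : Type*} {H : SimpleGraph V} (hH : IsIntervalGraph H)
    (s : Set V) : IsIntervalGraph (H.induce s) := by
  obtain ⟨l, r, hlr, hadj⟩ := hH
  exact ⟨fun v => l v, fun v => r v, fun v => hlr v, fun u v huv =>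
    hadj u v (Subtype.coe_injective.ne huv)⟩

/-- An interval graph on `V ∖ {x}` extends to one on `V` in which `x` is adjacent to every
other vertex. -/
theorem IsIntervalGraph.exists_extension {V : Type*} [Finite V] {x : V}
    {H : SimpleGraph ({x}ᶜ : Set V)} (hH : IsIntervalGraph H) :
    ∃ K : SimpleGraph V, IsIntervalGraph K ∧ (∀ v, v ≠ x → K.Adj x v) ∧
      K.induce ({x}ᶜ : Set V) = H := by
  classical
  obtain ⟨l, r, hlr, hadj⟩ := isIntervalGraph_iff.1 hH
  obtain ⟨a, ha⟩ := (Set.finite_range r).bddBelow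
  obtain ⟨b, hb⟩ := (Set.finite_range l).bddAbove
  have ha' : ∀ v, a ≤ r v := fun v => ha ⟨v, rfl⟩
  have hb' : ∀ v, l v ≤ b := fun v => hb ⟨v, rfl⟩
  let l' : V → ℝ := fun v => if h : v = x then min a b else l ⟨v, h⟩
  let r' : V → ℝ := fun v => if h : v = x then max a b else r ⟨v, h⟩
  have hlx : l' x = min a b := dif_pos rfl
  have hrx : r' x = max a b := dif_pos rfl
  have hl : ∀ v (h : v ≠ x), l' v = l ⟨v, h⟩ := fun v h => dif_neg h
  have hr : ∀ v (h : v ≠ x), r' v = r ⟨v, h⟩ := fun v h => dif_neg h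
  refine ⟨⟨fun u v => u ≠ v ∧ l' u ≤ r' v ∧ l' v ≤ r' u,
    ⟨fun u v h => ⟨h.1.symm, h.2.2, h.2.1⟩⟩, ⟨fun u h => h.1 rfl⟩⟩,
    isIntervalGraph_iff.2 ⟨l', r', fun v => ?_, fun u v => Iff.rfl⟩, fun v hv => ?_, ?_⟩
  · by_cases h : v = x
    · rw [h, hlx, hrx]
      exact min_le_max
    · rw [hl v h, hr v h]
      exact hlr _
  · refine ⟨hv.symm, ?_, ?_⟩
    · rw [hlx, hr v hv]
      exact (min_le_left a b).trans (ha' _)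
    · rw [hrx, hl v hv]
      exact (hb' _).trans (le_max_right a b)
  · ext u v
    rw [hadj]
    change (u : V) ≠ v ∧ l' u ≤ r' v ∧ l' v ≤ r' u ↔ _
    rw [hl u u.2, hl v v.2, hr u u.2, hr v v.2, ne_eq, Subtype.coe_inj]

/-- There is an interval graph in which `x` has its neighbors in `G` and all other vertices
form a clique. -/
theorem exists_isIntervalGraph_neighbors_clique {V : Type*} (G : SimpleGraph V) (x : V) :
    ∃ J : SimpleGraph V, IsIntervalGraph J ∧ (∀ v, J.Adj x v ↔ G.Adj x v) ∧
      ∀ u v, u ≠ x → v ≠ x → u ≠ v → J.Adj u v := by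
  classical
  let l : V → ℝ := fun v => if v = x ∨ G.Adj x v then 0 else 1
  let r : V → ℝ := fun v => if v = x then 0 else 1
  have hl : ∀ v, 0 ≤ l v ∧ l v ≤ 1 := fun v => by
    dsimp only [l]
    split_ifs <;> norm_num
  have hr : ∀ v, 0 ≤ r v := fun v => by
    dsimp only [r]
    split_ifs <;> norm_num
  have hlx : l x = 0 := if_pos (Or.inl rfl)
  have hrx : r x = 0 := if_pos rfl
  have hr1 : ∀ v, v ≠ x → r v = 1 := fun v hv => if_neg hv
  refine ⟨⟨fun u v => u ≠ v ∧ l u ≤ r v ∧ l v ≤ r u,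
    ⟨fun u v h => ⟨h.1.symm, h.2.2, h.2.1⟩⟩, ⟨fun u h => h.1 rfl⟩⟩,
    isIntervalGraph_iff.2 ⟨l, r, fun v => ?_, fun u v => Iff.rfl⟩, fun v => ?_,
    fun u v hu hv huv => ⟨huv, ?_, ?_⟩⟩
  · by_cases h : v = x
    · rw [h, hlx, hrx]
    · rw [hr1 v h]
      exact (hl v).2
  · change x ≠ v ∧ l x ≤ r v ∧ l v ≤ r x ↔ G.Adj x v
    rw [hlx, hrx]
    refine ⟨fun ⟨hne, _, h⟩ => ?_, fun h => ⟨h.ne, hr v, (if_pos (Or.inr h)).le⟩⟩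
    by_contra hn
    have : l v = 1 := if_neg (not_or.2 ⟨hne.symm, hn⟩)
    linarith
  · rw [hr1 v hv]
    exact (hl u).2
  · rw [hr1 u hu]
    exact (hl v).2

/-- For every finite simple graph `G` and vertex `x`,
`box(G) ≤ 1 + box(G - x)`. -/
theorem boxicity_le_one_add_boxicity_delete_vertex
    {V : Type*} [Fintype V] (G : SimpleGraph V) (x : V) :
    boxicity G ≤ 1 + boxicity (G.induce ({x}ᶜ : Set V)) := by
  rcases Set.eq_empty_or_nonempty {k | ∃ I : Fin k → SimpleGraph ({x}ᶜ : Set V),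
    (∀ i, IsIntervalGraph (I i)) ∧
      ∀ u v, (G.induce ({x}ᶜ : Set V)).Adj u v ↔ ∀ i, (I i).Adj u v} with hempty | hne
  · refine le_of_eq_of_le (Nat.sInf_eq_zero.2 (Or.inr ?_)) (Nat.zero_le _)
    refine Set.eq_empty_of_forall_notMem fun k ⟨I, hI, hadj⟩ => ?_
    exact Set.eq_empty_iff_forall_notMem.1 hempty k
      ⟨fun i => (I i).induce _, fun i => (hI i).induce _, fun u v => hadj u v⟩
  · have hmem := Nat.sInf_mem hne
    rw [← boxicity] at hmem
    obtain ⟨I, hI, hadj⟩ := hmem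
    choose K hK hKx hKI using fun i => (hI i).exists_extension
    obtain ⟨J, hJ, hJx, hJc⟩ := exists_isIntervalGraph_neighbors_clique G x
    rw [add_comm]
    refine Nat.sInf_le ⟨Fin.cons J K, Fin.cases hJ hK, fun u v => ?_⟩
    rw [Fin.forall_fin_succ]
    simp only [Fin.cons_zero, Fin.cons_succ]
    rcases eq_or_ne u v with rfl | huv
    · simp
    by_cases hu : u = x
    · subst hu
      rw [hJx, iff_self_and]
      exact fun _ i => hKx i v huv.symm
    by_cases hv : v = x
    · subst hv
      rw [J.adj_comm, hJx, G.adj_comm, iff_self_and]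
      exact fun _ i => (hKx i u huv).symm
    · rw [and_iff_right (hJc u v hu hv huv)]
      refine (hadj ⟨u, hu⟩ ⟨v, hv⟩).trans <| forall_congr' fun i => ?_
      rw [← hKI i]
      rfl
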